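/- (Liouville-type theorem.) Let μ be a Lévy measure on ℝ^N \ {0} with supp μ ≠ ∅. Let v : ℝ^N → ℝ be continuous with v(x) → 0 as |x| → ∞ (i.e. v ∈ C₀(ℝ^N)), and suppose that ∫_{ℝ^N} v(x) L^μ[ψ](x) dx = 0 for every ψ ∈ C_c^∞(ℝ^N), i.e. L^μ[v] = 0 in the sense of distributions. Then v(x) = 0 for all x ∈ ℝ^N. -/

import Mathlib

open MeasureTheory Set Filter

noncomputable section

/-- Euclidean space `ℝ^N`. -/
abbrev Euc (N : ℕ) := EuclideanSpace ℝ (Fin N)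

variable {N : ℕ}

/-- `μ` is a (symmetric) Lévy measure on `ℝ^N ∖ {0}` : it is a nonnegative measure giving no
mass to `{0}`, symmetric (`μ(−B) = μ(B)`), and `∫ min(|z|²,1) dμ(z) < ∞`. -/
def IsLevyMeasure (μ : Measure (Euc N)) : Prop :=
  μ {0} = 0 ∧ μ.map (fun z => -z) = μ ∧
    ∫⁻ z, ENNReal.ofReal (min (‖z‖ ^ 2) 1) ∂μ ≠ ⊤

/-- The nonlocal operator
`L^μ[ψ](x) = ∫ (ψ(x+z) − ψ(x) − z·Dψ(x) 1_{|z|≤1}) dμ(z)`. -/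
def Lop (μ : Measure (Euc N)) (ψ : Euc N → ℝ) (x : Euc N) : ℝ :=
  ∫ z, (ψ (x + z) - ψ x - (if ‖z‖ ≤ 1 then fderiv ℝ ψ x z else 0)) ∂μ

/-- `ψ ∈ C_c^∞(ℝ^N)`. -/
def IsTestFn (ψ : Euc N → ℝ) : Prop :=
  ContDiff ℝ (⊤ : ℕ∞) ψ ∧ HasCompactSupport ψ

/-- `ψ ∈ C_c^∞(ℝ^N × [0,T))` : smooth, compactly supported, and the support stays away
from `t = T` (but may touch `t = 0`). -/
def IsSTTestFn (T : ℝ) (ψ : Euc N → ℝ → ℝ) : Prop :=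
  ContDiff ℝ (⊤ : ℕ∞) (Function.uncurry ψ) ∧ HasCompactSupport (Function.uncurry ψ) ∧
    tsupport (Function.uncurry ψ) ⊆ {p : Euc N × ℝ | p.2 < T}

/-- `ψ ∈ C_c^∞(Q_T)` : smooth, compactly supported inside the open cylinder
`ℝ^N × (0,T)`. -/
def IsIntTestFn (T : ℝ) (ψ : Euc N → ℝ → ℝ) : Prop :=
  ContDiff ℝ (⊤ : ℕ∞) (Function.uncurry ψ) ∧ HasCompactSupport (Function.uncurry ψ) ∧
    tsupport (Function.uncurry ψ) ⊆ {p : Euc N × ℝ | 0 < p.2 ∧ p.2 < T}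

/-- The natural measure on the cylinder `Q_T = ℝ^N × (0,T)`. -/
def QTvol (N : ℕ) (T : ℝ) : Measure (Euc N × ℝ) :=
  (volume : Measure (Euc N)).prod ((volume : Measure ℝ).restrict (Ioo 0 T))

/-- `u ∈ L^∞(Q_T)`. -/
def MemLinfQT (T : ℝ) (u : Euc N → ℝ → ℝ) : Prop :=
  AEStronglyMeasurable (fun p : Euc N × ℝ => u p.1 p.2) (QTvol N T) ∧
    ∃ C : ℝ, ∀ᵐ p ∂(QTvol N T), |u p.1 p.2| ≤ C

/-- `u ∈ L¹(Q_T)`. -/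
def MemL1QT (T : ℝ) (u : Euc N → ℝ → ℝ) : Prop :=
  Integrable (fun p : Euc N × ℝ => u p.1 p.2) (QTvol N T)

/-- `u ∈ C([0,T]; L¹_loc(ℝ^N))` : for every compact `K`, `t ↦ u(·,t)` is continuous
from `[0,T]` into `L¹(K)`. -/
def MemCL1loc (T : ℝ) (u : Euc N → ℝ → ℝ) : Prop :=
  ∀ K : Set (Euc N), IsCompact K →
    (∀ t ∈ Icc (0 : ℝ) T, IntegrableOn (fun x => u x t) K) ∧
    ∀ t ∈ Icc (0 : ℝ) T,
      Tendsto (fun s => ∫ x in K, |u x s - u x t|) (nhdsWithin t (Icc 0 T)) (nhds 0)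

/-- `u` is a distributional solution of `∂_t u − A[φ(u)] = 0` in `Q_T` with initial
datum `u0` : for all `ψ ∈ C_c^∞(ℝ^N × [0,T))`,
`∫₀^T ∫ (u ∂_t ψ + φ(u) A[ψ(·,t)]) dx dt + ∫ u0(x) ψ(x,0) dx = 0`. -/
def IsDistSolOp (T : ℝ) (A : (Euc N → ℝ) → Euc N → ℝ) (φ : ℝ → ℝ)
    (u0 : Euc N → ℝ) (u : Euc N → ℝ → ℝ) : Prop :=
  ∀ ψ : Euc N → ℝ → ℝ, IsSTTestFn T ψ →
    (∫ t in Ioo (0 : ℝ) T, ∫ x,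
        (u x t * deriv (ψ x) t + φ (u x t) * A (fun y => ψ y t) x))
      + ∫ x, u0 x * ψ x 0 = 0

/-- `u0 ∈ L^∞(ℝ^N)`. -/
def MemLinfRn (u0 : Euc N → ℝ) : Prop :=
  AEStronglyMeasurable u0 (volume : Measure (Euc N)) ∧
    ∃ C : ℝ, ∀ᵐ x : Euc N ∂volume, |u0 x| ≤ C

end
section Auxiliary

variable {N : ℕ}

/-- The increment in the definition of `Lop`. -/
noncomputable def levyIncrement (φ : Euc N → ℝ) (y z : Euc N) : ℝ :=
  φ (y + z) - φ y - (if ‖z‖ ≤ 1 then fderiv ℝ φ y z else 0)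

/-- The correlation `x ↦ ∫ v (x + y) φ y dy`, a mollification of `v`. -/
noncomputable def corr (v φ : Euc N → ℝ) (x : Euc N) : ℝ := ∫ y, v (x + y) * φ y

theorem IsLevyMeasure.sFinite {μ : Measure (Euc N)} (hμ : IsLevyMeasure μ) : SFinite μ := by
  obtain ⟨h0, -, hfin⟩ := hμ
  have hm : Measurable fun z : Euc N => ENNReal.ofReal (min (‖z‖ ^ 2) 1) := by fun_prop
  have : IsFiniteMeasure (μ.withDensity fun z => ENNReal.ofReal (min (‖z‖ ^ 2) 1)) :=
    isFiniteMeasure_withDensity hfin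
  have hpos : ∀ᵐ z ∂μ, ENNReal.ofReal (min (‖z‖ ^ 2) 1) ≠ 0 := by
    have hz : ∀ᵐ z ∂μ, z ≠ 0 := by rw [ae_iff]; simpa using h0
    filter_upwards [hz] with z hz
    have : 0 < min (‖z‖ ^ 2) 1 := lt_min (by positivity) one_pos
    exact (ENNReal.ofReal_pos.2 this).ne'
  rw [← withDensity_inv_same hm hpos (ae_of_all _ fun z => ENNReal.ofReal_ne_top)]
  infer_instance

theorem IsLevyMeasure.integrable_min {μ : Measure (Euc N)} (hμ : IsLevyMeasure μ) :
    Integrable (fun z => min (‖z‖ ^ 2) 1) μ := by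
  refine (lintegral_ofReal_ne_top_iff_integrable
    (by fun_prop : Continuous fun z : Euc N => min (‖z‖ ^ 2) 1).measurable.aestronglyMeasurable
    (ae_of_all _ fun z => by positivity)).1 hμ.2.2

theorem IsTestFn.exists_taylor_bound {φ : Euc N → ℝ} (hφ : IsTestFn φ) :
    ∃ C : ℝ, 0 ≤ C ∧ ∀ y z, |φ (y + z) - φ y - fderiv ℝ φ y z| ≤ C * ‖z‖ ^ 2 := by
  obtain ⟨C, hC⟩ := ContDiff.lipschitzWith_of_hasCompactSupport (𝕂 := ℝ) (n := 1)
    (hφ.2.fderiv (𝕜 := ℝ))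
    (hφ.1.fderiv_right (m := 1) (WithTop.coe_le_coe.2 (OrderTop.le_top (1 + 1 : ℕ∞)))) one_ne_zero
  refine ⟨C, C.2, fun y z => ?_⟩
  have hd : Differentiable ℝ φ := hφ.1.differentiable (by simp)
  have key := (convex_segment (𝕜 := ℝ) y (y + z)).norm_image_sub_le_of_norm_hasFDerivWithin_le'
    (f := φ) (f' := fderiv ℝ φ) (φ := fderiv ℝ φ y) (C := C * ‖z‖)
    (fun x _ => (hd x).hasFDerivAt.hasFDerivWithinAt) (fun x hx => ?_)
    (left_mem_segment ℝ y (y + z)) (right_mem_segment ℝ y (y + z))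
  · simpa [Real.norm_eq_abs, pow_two, mul_assoc] using key
  · refine (hC.norm_sub_le x y).trans (mul_le_mul_of_nonneg_left ?_ C.2)
    simpa using norm_sub_le_of_mem_segment hx

theorem IsTestFn.integrable {φ : Euc N → ℝ} (hφ : IsTestFn φ) : Integrable φ :=
  hφ.1.continuous.integrable_of_hasCompactSupport hφ.2

theorem IsTestFn.integrable_levyIncrement {φ : Euc N → ℝ} (hφ : IsTestFn φ) (z : Euc N) :
    Integrable fun y => levyIncrement φ y z := by
  refine ((hφ.integrable.comp_add_right z).sub hφ.integrable).sub ?_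
  split_ifs
  · have hc : Continuous (fderiv ℝ φ) := hφ.1.continuous_fderiv (by simp)
    refine Continuous.integrable_of_hasCompactSupport (by fun_prop) ?_
    exact (hφ.2.fderiv (𝕜 := ℝ)).comp_left (g := fun T : Euc N →L[ℝ] ℝ => T z) (by simp)
  · simp

theorem IsTestFn.exists_integral_abs_levyIncrement_le {φ : Euc N → ℝ} (hφ : IsTestFn φ) :
    ∃ C : ℝ, 0 ≤ C ∧ ∀ z, ∫ y, |levyIncrement φ y z| ≤ C * min (‖z‖ ^ 2) 1 := by
  obtain ⟨C, hC0, hC⟩ := hφ.exists_taylor_bound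
  set K : Set (Euc N) := Metric.cthickening 1 (tsupport φ) with hK
  have hKc : IsCompact K := hφ.2.isCompact.cthickening
  have hKfin : volume K ≠ ⊤ := hKc.measure_ne_top
  refine ⟨C * volume.real K + 2 * ∫ y, |φ y|, by positivity, fun z => ?_⟩
  have hI : 0 ≤ ∫ y, |φ y| := by positivity
  by_cases hz : ‖z‖ ≤ 1
  · have hmin : min (‖z‖ ^ 2) 1 = ‖z‖ ^ 2 := min_eq_left (by nlinarith [norm_nonneg z])
    have hle : ∀ y, |levyIncrement φ y z| ≤ K.indicator (fun _ => C * ‖z‖ ^ 2) y := by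
      intro y
      by_cases hy : y ∈ K
      · simpa [levyIncrement, hz, hy] using hC y z
      · have h1 : y ∉ tsupport φ := fun h => hy (Metric.self_subset_cthickening _ h)
        have h2 : y + z ∉ tsupport φ := fun h => hy
          (Metric.mem_cthickening_of_dist_le y (y + z) 1 _ h (by simpa [dist_eq_norm] using hz))
        have h3 : fderiv ℝ φ y = 0 :=
          image_eq_zero_of_notMem_tsupport fun h => h1 (tsupport_fderiv_subset ℝ h)
        simp [levyIncrement, hy, h3, image_eq_zero_of_notMem_tsupport h1,
          image_eq_zero_of_notMem_tsupport h2]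
    calc ∫ y, |levyIncrement φ y z| ≤ ∫ y, K.indicator (fun _ => C * ‖z‖ ^ 2) y :=
          integral_mono (hφ.integrable_levyIncrement z).abs
            ((integrable_indicator_iff hKc.measurableSet).2 (integrableOn_const hKfin)) hle
      _ = C * volume.real K * ‖z‖ ^ 2 := by
          rw [integral_indicator hKc.measurableSet, setIntegral_const, smul_eq_mul]; ring
      _ ≤ _ := by rw [hmin]; gcongr; linarith
  · have hmin : min (‖z‖ ^ 2) 1 = 1 := min_eq_right (by nlinarith [not_le.1 hz])
    calc ∫ y, |levyIncrement φ y z| ≤ ∫ y, (|φ (y + z)| + |φ y|) := by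
          refine integral_mono (hφ.integrable_levyIncrement z).abs
            ((hφ.integrable.comp_add_right z).abs.add hφ.integrable.abs) fun y => ?_
          simpa [levyIncrement, hz] using abs_sub (φ (y + z)) (φ y)
      _ = 2 * ∫ y, |φ y| := by
          rw [integral_add (hφ.integrable.comp_add_right z).abs hφ.integrable.abs,
            integral_add_right_eq_self (fun y => |φ y|) z]
          ring
      _ ≤ _ := by
          rw [hmin, mul_one]
          have : 0 ≤ C * volume.real K := by positivity
          linarith

theorem IsTestFn.measurable_levyIncrement {φ : Euc N → ℝ} (hφ : IsTestFn φ) :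
    Measurable fun p : Euc N × Euc N => levyIncrement φ p.1 p.2 := by
  have hφc : Continuous φ := hφ.1.continuous
  have hc : Continuous (fderiv ℝ φ) := hφ.1.continuous_fderiv (by simp)
  refine ((by fun_prop : Continuous fun p : Euc N × Euc N =>
    φ (p.1 + p.2) - φ p.1).measurable).sub ?_
  refine Measurable.ite (measurableSet_le (by fun_prop) measurable_const) ?_ measurable_const
  exact (by fun_prop : Continuous fun p : Euc N × Euc N => fderiv ℝ φ p.1 p.2).measurable

theorem integrable_mul_levyIncrement {μ : Measure (Euc N)} (hμ : IsLevyMeasure μ)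
    {φ : Euc N → ℝ} (hφ : IsTestFn φ) {v : Euc N → ℝ} (hv : Continuous v)
    {M : ℝ} (hM : ∀ x, |v x| ≤ M) :
    Integrable (fun p : Euc N × Euc N => v p.1 * levyIncrement φ p.1 p.2) (volume.prod μ) := by
  have := hμ.sFinite
  obtain ⟨C, -, hC⟩ := hφ.exists_integral_abs_levyIncrement_le
  have hmeas : AEStronglyMeasurable (fun p : Euc N × Euc N => levyIncrement φ p.1 p.2)
      (volume.prod μ) := hφ.measurable_levyIncrement.aestronglyMeasurable
  refine Integrable.bdd_mul (c := M) ?_ (hv.comp continuous_fst).aestronglyMeasurable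
    (ae_of_all _ fun p => hM p.1)
  refine (integrable_prod_iff' hmeas).2 ⟨ae_of_all _ hφ.integrable_levyIncrement, ?_⟩
  refine (hμ.integrable_min.const_mul C).mono' hmeas.norm.prod_swap.integral_prod_right'
    (ae_of_all _ fun z => ?_)
  rw [Real.norm_of_nonneg (integral_nonneg fun y => norm_nonneg _)]
  exact hC z

theorem corr_continuous {φ : Euc N → ℝ} (hφ : IsTestFn φ) {v : Euc N → ℝ} (hv : Continuous v)
    {M : ℝ} (hM : ∀ x, |v x| ≤ M) : Continuous (corr v φ) := by
  have hφc : Continuous φ := hφ.1.continuous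
  refine continuous_of_dominated (bound := fun y => M * |φ y|)
    (fun x => Continuous.aestronglyMeasurable (by fun_prop)) (fun x => ae_of_all _ fun y => ?_)
    (hφ.integrable.abs.const_mul M) (ae_of_all _ fun y => by fun_prop)
  rw [norm_mul]
  exact mul_le_mul_of_nonneg_right (hM _) (abs_nonneg _)

theorem corr_tendsto_zero {φ : Euc N → ℝ} (hφ : IsTestFn φ) {v : Euc N → ℝ} (hv : Continuous v)
    (hv0 : Tendsto v (cocompact (Euc N)) (nhds 0)) {M : ℝ} (hM : ∀ x, |v x| ≤ M) :
    Tendsto (corr v φ) (cocompact (Euc N)) (nhds 0) := by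
  have hφc : Continuous φ := hφ.1.continuous
  rw [← integral_zero (Euc N) ℝ (μ := volume)]
  have : (cocompact (Euc N)).IsCountablyGenerated := by
    rw [← Metric.cobounded_eq_cocompact, ← comap_norm_atTop]
    infer_instance
  refine tendsto_integral_filter_of_dominated_convergence (fun y => M * |φ y|)
    (Eventually.of_forall fun x => Continuous.aestronglyMeasurable (by fun_prop))
    (Eventually.of_forall fun x => ae_of_all _ fun y => ?_)
    (hφ.integrable.abs.const_mul M) (ae_of_all _ fun y => ?_)
  · rw [norm_mul]
    exact mul_le_mul_of_nonneg_right (hM _) (abs_nonneg _)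
  · simpa using (hv0.comp (Homeomorph.addRight y).isClosedEmbedding.tendsto_cocompact).mul_const
      (φ y)

theorem Lop_comp_sub (μ : Measure (Euc N)) (φ : Euc N → ℝ) (x y : Euc N) :
    Lop μ (fun u => φ (u - x)) y = Lop μ φ (y - x) := by
  simp only [Lop, fderiv_comp_sub, sub_add_eq_add_sub]

/-- If `L^μ[v] = 0` in the sense of distributions, every mollification of `v` satisfies the
symmetrized equation pointwise. -/
theorem corr_second_difference {μ : Measure (Euc N)} (hμ : IsLevyMeasure μ)
    {φ : Euc N → ℝ} (hφ : IsTestFn φ) {v : Euc N → ℝ} (hv : Continuous v)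
    {M : ℝ} (hM : ∀ x, |v x| ≤ M)
    (hsol : ∀ ψ : Euc N → ℝ, IsTestFn ψ → ∫ x, v x * Lop μ ψ x = 0) (x : Euc N) :
    Integrable (fun z => corr v φ (x - z) + corr v φ (x + z) - 2 * corr v φ x) μ ∧
      ∫ z, (corr v φ (x - z) + corr v φ (x + z) - 2 * corr v φ x) ∂μ = 0 := by
  have := hμ.sFinite
  have hvx : Continuous fun y => v (x + y) := by fun_prop
  have hI := integrable_mul_levyIncrement hμ hφ hvx (fun y => hM (x + y))
  set H : Euc N → ℝ := fun z => ∫ y, v (x + y) * levyIncrement φ y z with hH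
  have hHint : Integrable H μ := hI.integral_prod_right
  have hH0 : ∫ z, H z ∂μ = 0 := by
    rw [hH, integral_integral_swap (f := fun z y => v (x + y) * levyIncrement φ y z) hI.swap]
    have h1 : IsTestFn fun u => φ (u - x) :=
      ⟨hφ.1.comp (contDiff_id.sub contDiff_const),
        hφ.2.comp_homeomorph (Homeomorph.subRight x)⟩
    have h2 := hsol _ h1
    rw [← integral_add_left_eq_self _ x] at h2
    simp only [Lop_comp_sub, add_sub_cancel_left] at h2
    rw [← h2]
    refine integral_congr_ae (ae_of_all _ fun y => ?_)
    exact integral_const_mul _ _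
  have hmul : ∀ {g : Euc N → ℝ}, Integrable g → Integrable fun y => v (x + y) * g y :=
    fun hg => hg.bdd_mul hvx.aestronglyMeasurable (ae_of_all _ fun y => hM (x + y))
  have hshift : ∀ z, ∫ y, v (x + y) * φ (y + z) = corr v φ (x - z) := by
    intro z
    rw [corr, ← integral_add_right_eq_self (fun y => v (x - z + y) * φ y) z]
    refine integral_congr_ae (ae_of_all _ fun y => ?_)
    simp only
    congr 2
    module
  have hsum : ∀ z, H z + H (-z) = corr v φ (x - z) + corr v φ (x + z) - 2 * corr v φ x := by
    intro z
    have e1 := hmul (hφ.integrable_levyIncrement z)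
    have e2 := hmul (hφ.integrable_levyIncrement (-z))
    have a1 := hmul (hφ.integrable.comp_add_right z)
    have a2 := hmul (hφ.integrable.comp_add_right (-z))
    have a0 := (hmul hφ.integrable).const_mul 2
    rw [hH]
    simp only
    rw [← integral_add e1 e2]
    have : corr v φ (x + z) = corr v φ (x - -z) := by rw [sub_neg_eq_add]
    rw [this, ← hshift z, ← hshift (-z), corr, ← integral_const_mul, ← integral_add a1 a2,
      ← integral_sub (by exact a1.add a2) a0]
    refine integral_congr_ae (ae_of_all _ fun y => ?_)
    simp only [levyIncrement, norm_neg, map_neg]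
    split_ifs <;> ring
  have hneg : MeasurePreserving (fun z : Euc N => -z) μ μ := ⟨measurable_neg, hμ.2.1⟩
  have hHneg : Integrable (fun z => H (-z)) μ := hneg.integrable_comp_of_integrable hHint
  have hHneg0 : ∫ z, H (-z) ∂μ = 0 := by
    rw [← hH0]
    exact hneg.integral_comp (MeasurableEquiv.neg (Euc N)).measurableEmbedding H
  simp only [← hsum]
  exact ⟨hHint.add hHneg, by rw [integral_add hHint hHneg, hH0, hHneg0, add_zero]⟩

/-- A continuous function vanishing at infinity is nonpositive if the set of its maximum points
is invariant under a nonzero translation. -/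
theorem nonpos_of_max_translate {w : Euc N → ℝ} (hw : Continuous w)
    (hw0 : Tendsto w (cocompact (Euc N)) (nhds 0)) {z₀ : Euc N} (hz₀ : z₀ ≠ 0)
    (hmax : ∀ x, (∀ y, w y ≤ w x) → w (x - z₀) = w x) (x : Euc N) : w x ≤ 0 := by
  by_contra! hx
  obtain ⟨x₁, hx₁⟩ := hw.exists_forall_ge' x ((hw0.eventually_lt_const hx).mono fun _ h => h.le)
  have hiter : ∀ n : ℕ, w (x₁ - (n : ℝ) • z₀) = w x₁ := by
    intro n
    induction n with
    | zero => simp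
    | succ k ih =>
      have := hmax (x₁ - (k : ℝ) • z₀) (by rwa [ih])
      rw [← ih, ← this]
      congr 1
      push_cast
      module
  have hlim : Tendsto (fun n : ℕ => x₁ - (n : ℝ) • z₀) atTop (cocompact (Euc N)) := by
    rw [← Metric.cobounded_eq_cocompact, ← comap_norm_atTop, tendsto_comap_iff]
    refine tendsto_atTop_mono (f := fun n : ℕ => (n : ℝ) * ‖z₀‖ + -‖x₁‖) (fun n => ?_) ?_
    · have := norm_sub_norm_le ((n : ℝ) • z₀) x₁
      rw [norm_smul, Real.norm_natCast, norm_sub_rev] at this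
      simpa [sub_eq_add_neg] using this
    · exact tendsto_atTop_add_const_right _ _
        (tendsto_natCast_atTop_atTop.atTop_mul_const (norm_pos_iff.2 hz₀))
  have h0 := hw0.comp hlim
  have : w x₁ = 0 := tendsto_nhds_unique
    (by simpa only [Function.comp_def, hiter] using tendsto_const_nhds) h0
  linarith [hx₁ x]

theorem corr_nonpos {μ : Measure (Euc N)} (hμ : IsLevyMeasure μ) (hne : μ {0}ᶜ ≠ 0)
    {v : Euc N → ℝ} (hv : Continuous v) (hv0 : Tendsto v (cocompact (Euc N)) (nhds 0))
    {M : ℝ} (hM : ∀ x, |v x| ≤ M)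
    (hsol : ∀ ψ : Euc N → ℝ, IsTestFn ψ → ∫ x, v x * Lop μ ψ x = 0)
    {φ : Euc N → ℝ} (hφ : IsTestFn φ) (x : Euc N) : corr v φ x ≤ 0 := by
  obtain ⟨z₀, hz₀, hpos⟩ := exists_mem_forall_mem_nhdsWithin_pos_measure hne
  have hw := corr_continuous hφ hv hM
  refine nonpos_of_max_translate hw (corr_tendsto_zero hφ hv hv0 hM) hz₀ (fun x hx => ?_) x
  obtain ⟨hint, hzero⟩ := corr_second_difference hμ hφ hv hM hsol x
  have hnonneg : 0 ≤ fun z => -(corr v φ (x - z) + corr v φ (x + z) - 2 * corr v φ x) := by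
    intro z
    simp only [Pi.zero_apply]
    linarith [hx (x - z), hx (x + z)]
  have hae := (integral_eq_zero_iff_of_nonneg hnonneg hint.neg).1
    (by rw [integral_neg, hzero, neg_zero])
  by_contra hneq
  have hopen : IsOpen {z | corr v φ (x - z) ≠ corr v φ x} :=
    isOpen_ne_fun (by fun_prop) continuous_const
  refine (hpos _ (mem_nhdsWithin_of_mem_nhds (hopen.mem_nhds hneq))).ne' ?_
  refine measure_mono_null (fun z hz => ?_) (ae_iff.1 hae)
  intro h
  simp only [Pi.zero_apply] at h
  exact hz (by linarith [hx (x - z), hx (x + z)])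

theorem exists_abs_le_of_tendsto_zero {v : Euc N → ℝ} (hv : Continuous v)
    (hv0 : Tendsto v (cocompact (Euc N)) (nhds 0)) : ∃ M : ℝ, ∀ x, |v x| ≤ M := by
  let f : ZeroAtInftyContinuousMap (Euc N) ℝ := ⟨⟨v, hv⟩, hv0⟩
  exact ⟨‖f.toBCF‖, fun x => f.toBCF.norm_coe_le_norm x⟩

end Auxiliary

/-- Liouville-type theorem (Theorem 3.8). If `supp μ ≠ ∅`, `v ∈ C₀(ℝ^N)` and
`L^μ[v] = 0` in `𝒟'(ℝ^N)`, then `v ≡ 0`. -/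
theorem liouville_type_theorem
    (N : ℕ) (hN : 0 < N)
    (μ : Measure (Euc N)) (hμ : IsLevyMeasure μ)
    (hsupp : ∃ x₀ : Euc N, ∀ r : ℝ, 0 < r → 0 < μ (Metric.ball x₀ r \ {0}))
    (v : Euc N → ℝ) (hvc : Continuous v)
    (hv0 : Tendsto v (Filter.cocompact (Euc N)) (nhds 0))
    (hsol : ∀ ψ : Euc N → ℝ, IsTestFn ψ → ∫ x, v x * Lop μ ψ x = 0) :
    ∀ x : Euc N, v x = 0 := by
  obtain ⟨M, hM⟩ := exists_abs_le_of_tendsto_zero hvc hv0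
  have hne : μ {0}ᶜ ≠ 0 := by
    obtain ⟨x₀, hx₀⟩ := hsupp
    exact ((hx₀ 1 one_pos).trans_le (measure_mono fun z hz => hz.2)).ne'
  have hae : ∀ᵐ x : Euc N, v x = 0 := by
    refine ae_eq_zero_of_integral_contDiff_smul_eq_zero hvc.locallyIntegrable
      fun φ hφ hφc => ?_
    have h1 := corr_nonpos hμ hne hvc hv0 hM hsol ⟨hφ, hφc⟩ 0
    have h2 := corr_nonpos (v := fun x => -v x) hμ hne hvc.neg (by simpa using hv0.neg)
      (fun x => by simpa using hM x)
      (fun ψ hψ => by simp only [neg_mul, integral_neg, hsol ψ hψ, neg_zero]) ⟨hφ, hφc⟩ 0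
    simp only [corr, zero_add, neg_mul, integral_neg] at h1 h2
    simp only [smul_eq_mul, mul_comm (φ _)]
    linarith
  exact congrFun ((hvc.ae_eq_iff_eq volume continuous_const).1 hae)
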